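/- Let S be a 1-separated subset of the unit sphere S_X of the Petty space and set D₀ = {(x,y,z) ∈ S_X : −1/3 ≤ z ≤ 1/3}. If S ∩ D₀ has exactly 10 elements, then S has at most 16 elements. -/

import Mathlib

/-- The Petty norm on ℝ³: ‖(x,y,z)‖ = √(x²+y²) + |z|. -/
noncomputable def pettyNorm (a : ℝ × ℝ × ℝ) : ℝ :=
  Real.sqrt (a.1 ^ 2 + a.2.1 ^ 2) + |a.2.2|

/-- The Petty distance on ℝ³. -/
noncomputable def pettyDist (a b : ℝ × ℝ × ℝ) : ℝ := pettyNorm (a - b)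

/-- The unit sphere of the Petty space. -/
def pettySphere : Set (ℝ × ℝ × ℝ) := {a | pettyNorm a = 1}

/-- A set is 1-separated if all pairwise Petty distances are ≥ 1. -/
def OneSeparated (S : Set (ℝ × ℝ × ℝ)) : Prop :=
  ∀ a ∈ S, ∀ b ∈ S, a ≠ b → 1 ≤ pettyDist a b

/-!
The proof shows that the middle band `D₀` of the sphere contains no 1-separated set of ten points.
A point of the sphere is described by the angle `azimuth` of its horizontal part and its height.
1-separation bounds the difference of two azimuths from below in terms of the heights
(`angleBound_le`). Summing these bounds over consecutive and next-to-consecutive points, in the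
cyclic order of the azimuths, gives more than two full turns.
-/

/-! ### A lower bound for the cosine -/

theorem le_of_forall_hasDerivAt_nonneg {f f' : ℝ → ℝ} (hf : ∀ x, HasDerivAt f (f' x) x)
    (hf' : ∀ x, 0 ≤ x → 0 ≤ f' x) {x : ℝ} (hx : 0 ≤ x) : f 0 ≤ f x := by
  refine monotoneOn_of_deriv_nonneg (convex_Ici 0)
    (fun y _ => (hf y).continuousAt.continuousWithinAt)
    (fun y _ => (hf y).differentiableAt.differentiableWithinAt) (fun y hy => ?_)
    Set.self_mem_Ici hx hx
  rw [(hf y).deriv]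
  exact hf' y (interior_subset hy)

theorem cos_taylor_six_le {x : ℝ} (hx : 0 ≤ x) :
    1 - x ^ 2 / 2 + x ^ 4 / 24 - x ^ 6 / 720 ≤ Real.cos x := by
  have sin_ge : ∀ x : ℝ, 0 ≤ x → 0 ≤ Real.sin x - (x - x ^ 3 / 6) := fun x hx => by
    have h := le_of_forall_hasDerivAt_nonneg (f := fun x => Real.sin x - (x - x ^ 3 / 6))
      (fun x => (Real.hasDerivAt_sin x).sub ((hasDerivAt_id x).sub ((hasDerivAt_pow 3 x).div_const 6)))
      (fun x _ => by have := Real.one_sub_sq_div_two_le_cos (x := x); norm_num; linarith) hx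
    simpa using h
  have cos_le : ∀ x : ℝ, 0 ≤ x → 0 ≤ 1 - x ^ 2 / 2 + x ^ 4 / 24 - Real.cos x := fun x hx => by
    have h := le_of_forall_hasDerivAt_nonneg (f := fun x => 1 - x ^ 2 / 2 + x ^ 4 / 24 - Real.cos x)
      (fun x => ((((hasDerivAt_pow 2 x).div_const 2).const_sub 1).add
        ((hasDerivAt_pow 4 x).div_const 24)).sub (Real.hasDerivAt_cos x))
      (fun x hx => by have := sin_ge x hx; norm_num; linarith) hx
    simpa using h
  have sin_le : ∀ x : ℝ, 0 ≤ x → 0 ≤ x - x ^ 3 / 6 + x ^ 5 / 120 - Real.sin x := fun x hx => by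
    have h := le_of_forall_hasDerivAt_nonneg (f := fun x => x - x ^ 3 / 6 + x ^ 5 / 120 - Real.sin x)
      (fun x => (((hasDerivAt_id x).sub ((hasDerivAt_pow 3 x).div_const 6)).add
        ((hasDerivAt_pow 5 x).div_const 120)).sub (Real.hasDerivAt_sin x))
      (fun x hx => by have := cos_le x hx; norm_num; linarith) hx
    simpa using h
  have h := le_of_forall_hasDerivAt_nonneg
    (f := fun x => Real.cos x - (1 - x ^ 2 / 2 + x ^ 4 / 24 - x ^ 6 / 720))
    (fun x => (Real.hasDerivAt_cos x).sub (((((hasDerivAt_pow 2 x).div_const 2).const_sub 1).add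
      ((hasDerivAt_pow 4 x).div_const 24)).sub ((hasDerivAt_pow 6 x).div_const 720)))
    (fun x hx => by have := sin_le x hx; norm_num; linarith) hx
  simp at h
  linarith

/-! ### Tables -/

/-- The lower end, times 21, of the `j`-th of five levels of absolute heights. -/
def levelMin : Fin 5 → ℕ := ![0, 1, 4, 5, 6]

/-- The upper end, times 21, of the `j`-th of five levels of absolute heights. -/
def levelMax : Fin 5 → ℕ := ![1, 4, 5, 6, 7]

/-- Lower bounds, in thousandths of a radian, for the azimuth difference of two 1-separated points
on given levels; the Boolean says whether the points lie on opposite sides of the equator. -/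
def angleBound : Bool → Fin 5 → Fin 5 → ℕ
  | false => ![![1018, 905, 854, 795, 722], ![905, 1004, 960, 908, 846],
      ![854, 960, 1300, 1265, 1225], ![795, 908, 1265, 1400, 1365], ![722, 846, 1225, 1365, 1520]]
  | true => ![![989, 880, 831, 774, 703], ![880, 784, 741, 691, 628],
      ![831, 741, 701, 653, 595], ![774, 691, 653, 609, 554], ![703, 628, 595, 554, 505]]

/-- A potential on pairs of consecutive points which averages out the bounds `angleBound`. -/
def potential : Bool → Fin 5 → Fin 5 → ℕ
  | false => ![![0, 0, 0, 0, 5], ![0, 0, 0, 0, 31], ![0, 0, 0, 0, 0],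
      ![0, 0, 0, 0, 0], ![154, 30, 0, 0, 0]]
  | true => ![![0, 0, 0, 0, 0], ![0, 93, 136, 140, 0], ![0, 77, 117, 48, 78],
      ![4, 87, 107, 97, 152], ![173, 248, 156, 75, 124]]

set_option maxRecDepth 10000 in
theorem potential_step (d e : Bool) (i j k : Fin 5) :
    1257 + potential d i j ≤
      max (angleBound d i j + angleBound e j k) (angleBound (d ^^ e) i k) + potential e j k := by
  revert d e i j k
  decide

theorem angleBound_pos (d : Bool) (i j : Fin 5) : 0 < angleBound d i j := by
  revert d i j
  decide

theorem angleBound_le_3000 (d : Bool) (i j : Fin 5) : angleBound d i j ≤ 3000 := by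
  revert d i j
  decide

/-! ### Cosine bounds for pairs of points -/

/-- The largest cosine of the azimuth difference of 1-separated points at heights `a` and `-b`. -/
noncomputable def oppCos (a b : ℝ) : ℝ := (1 - 2 * a * b) / (2 * (1 - a) * (1 - b))

/-- The largest cosine of the azimuth difference of 1-separated points at heights `a ≤ b`. -/
noncomputable def sameCos (a b : ℝ) : ℝ := (1 - 4 * a + 2 * a * b) / (2 * (1 - a) * (1 - b))

theorem oppCos_mono {a b A B : ℝ} (ha : 0 ≤ a) (haA : a ≤ A) (hA : A ≤ 1 / 3)
    (hb : 0 ≤ b) (hbB : b ≤ B) (hB : B ≤ 1 / 3) : oppCos a b ≤ oppCos A B := by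
  have left : oppCos a b ≤ oppCos A b := by
    unfold oppCos
    rw [div_le_div_iff₀ (by nlinarith) (by nlinarith)]
    have : 0 ≤ 2 * ((1 - b) * ((A - a) * (1 - 2 * b))) :=
      mul_nonneg two_pos.le (mul_nonneg (by linarith) (mul_nonneg (by linarith) (by linarith)))
    linarith
  have right : oppCos A b ≤ oppCos A B := by
    unfold oppCos
    rw [div_le_div_iff₀ (by nlinarith) (by nlinarith)]
    have : 0 ≤ 2 * ((1 - A) * ((B - b) * (1 - 2 * A))) :=
      mul_nonneg two_pos.le (mul_nonneg (by linarith) (mul_nonneg (by linarith) (by linarith)))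
    linarith
  exact left.trans right

theorem sameCos_mono {a b A B : ℝ} (hAa : A ≤ a) (ha : a ≤ 1 / 3)
    (hbB : b ≤ B) (hB : B ≤ 1 / 3) : sameCos a b ≤ sameCos A B := by
  have left : sameCos a b ≤ sameCos A b := by
    unfold sameCos
    rw [div_le_div_iff₀ (by nlinarith) (by nlinarith)]
    have : 0 ≤ 2 * ((1 - b) * ((a - A) * (3 - 2 * b))) :=
      mul_nonneg two_pos.le (mul_nonneg (by linarith) (mul_nonneg (by linarith) (by linarith)))
    linarith
  have right : sameCos A b ≤ sameCos A B := by
    unfold sameCos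
    rw [div_le_div_iff₀ (by nlinarith) (by nlinarith)]
    have : 0 ≤ 2 * ((1 - A) * ((B - b) * (1 - 2 * A))) :=
      mul_nonneg two_pos.le (mul_nonneg (by linarith) (mul_nonneg (by linarith) (by linarith)))
    linarith
  exact left.trans right

theorem oppCos_le_cos_angleBound (i j : Fin 5) :
    oppCos (levelMax i / 21) (levelMax j / 21) ≤
      Real.cos (angleBound true i j / 1000) := by
  refine le_trans ?_ (cos_taylor_six_le (by positivity))
  fin_cases i <;> fin_cases j <;> norm_num [oppCos, levelMax, angleBound]

theorem sameCos_le_cos_angleBound (i j : Fin 5) :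
    sameCos ((min (levelMin i) (levelMin j) : ℕ) / 21) ((max (levelMax i) (levelMax j) : ℕ) / 21) ≤
      Real.cos (angleBound false i j / 1000) := by
  refine le_trans ?_ (cos_taylor_six_le (by positivity))
  fin_cases i <;> fin_cases j <;> norm_num [sameCos, levelMin, levelMax, angleBound]

/-! ### Points of the middle band -/

/-- The middle band `D₀` of the sphere. -/
def middleBand : Set (ℝ × ℝ × ℝ) := {a ∈ pettySphere | -(1/3) ≤ a.2.2 ∧ a.2.2 ≤ 1/3}

/-- The angle of the horizontal part of a point. -/
noncomputable def azimuth (a : ℝ × ℝ × ℝ) : ℝ := Complex.arg ⟨a.1, a.2.1⟩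

theorem exists_level {u : ℝ} (h0 : 0 ≤ u) (h1 : u ≤ 1 / 3) :
    ∃ j : Fin 5, (levelMin j / 21 : ℝ) ≤ u ∧ u ≤ (levelMax j / 21 : ℝ) := by
  by_contra! h
  have h₀ := h 0
  have h₁ := h 1
  have h₂ := h 2
  have h₃ := h 3
  have h₄ := h 4
  simp [levelMin, levelMax] at h₀ h₁ h₂ h₃ h₄
  grind

theorem levelMax_le (i : Fin 5) : levelMax i ≤ 7 := by
  revert i
  decide

theorem coords_of_mem_pettySphere {a : ℝ × ℝ × ℝ} (ha : a ∈ pettySphere) :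
    a.1 = (1 - |a.2.2|) * Real.cos (azimuth a) ∧ a.2.1 = (1 - |a.2.2|) * Real.sin (azimuth a) := by
  have hr : 1 - |a.2.2| = ‖(⟨a.1, a.2.1⟩ : ℂ)‖ := by
    have h : pettyNorm a = 1 := ha
    rw [Complex.norm_eq_sqrt_sq_add_sq]
    unfold pettyNorm at h
    linarith
  rw [hr]
  exact ⟨(Complex.norm_mul_cos_arg ⟨a.1, a.2.1⟩).symm,
    (Complex.norm_mul_sin_arg ⟨a.1, a.2.1⟩).symm⟩

theorem cos_azimuth_sub_le {a b : ℝ × ℝ × ℝ} (ha : a ∈ middleBand) (hb : b ∈ middleBand)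
    (hab : 1 ≤ pettyDist a b) :
    2 * (1 - |a.2.2|) * (1 - |b.2.2|) * Real.cos (azimuth a - azimuth b) ≤
      (1 - |a.2.2|) ^ 2 + (1 - |b.2.2|) ^ 2 - (1 - |a.2.2 - b.2.2|) ^ 2 := by
  obtain ⟨hxa, hya⟩ := coords_of_mem_pettySphere ha.1
  obtain ⟨hxb, hyb⟩ := coords_of_mem_pettySphere hb.1
  have hz : |a.2.2 - b.2.2| ≤ 1 :=
    abs_le.2 ⟨by linarith [ha.2.1, hb.2.2], by linarith [ha.2.2, hb.2.1]⟩
  have hsq : (1 - |a.2.2 - b.2.2|) ^ 2 ≤ (a.1 - b.1) ^ 2 + (a.2.1 - b.2.1) ^ 2 := by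
    refine (Real.le_sqrt (by linarith) (by positivity)).1 ?_
    have : 1 ≤ Real.sqrt ((a.1 - b.1) ^ 2 + (a.2.1 - b.2.1) ^ 2) + |a.2.2 - b.2.2| := hab
    linarith
  rw [hxa, hya, hxb, hyb] at hsq
  rw [Real.cos_sub]
  generalize azimuth a = α at *
  generalize azimuth b = β at *
  linear_combination hsq + (1 - |a.2.2|) ^ 2 * Real.sin_sq_add_cos_sq α +
    (1 - |b.2.2|) ^ 2 * Real.sin_sq_add_cos_sq β

/-- Is the point in the lower half-space? -/
noncomputable def isLower (a : ℝ × ℝ × ℝ) : Bool := decide (a.2.2 < 0)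

theorem exists_level_of_mem {a : ℝ × ℝ × ℝ} (ha : a ∈ middleBand) : ∃ j : Fin 5,
    (levelMin j / 21 : ℝ) ≤ |a.2.2| ∧ |a.2.2| ≤ (levelMax j / 21 : ℝ) :=
  exists_level (abs_nonneg _) (abs_le.2 ⟨ha.2.1, ha.2.2⟩)

open Classical in
/-- The level of the height of a point of the middle band. -/
noncomputable def level (a : ℝ × ℝ × ℝ) : Fin 5 :=
  if ha : a ∈ middleBand then (exists_level_of_mem ha).choose else 0

theorem level_spec {a : ℝ × ℝ × ℝ} (ha : a ∈ middleBand) :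
    (levelMin (level a) / 21 : ℝ) ≤ |a.2.2| ∧
      |a.2.2| ≤ (levelMax (level a) / 21 : ℝ) := by
  rw [level, dif_pos ha]
  exact (exists_level_of_mem ha).choose_spec

/-- The lower bound, in thousandths of a radian, for the azimuth difference of `a` and `b`. -/
noncomputable def pairBound (a b : ℝ × ℝ × ℝ) : ℕ :=
  angleBound (isLower a ^^ isLower b) (level a) (level b)

theorem cos_azimuth_sub_le_cos_pairBound {a b : ℝ × ℝ × ℝ} (ha : a ∈ middleBand)
    (hb : b ∈ middleBand) (hab : 1 ≤ pettyDist a b) :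
    Real.cos (azimuth a - azimuth b) ≤ Real.cos (pairBound a b / 1000) := by
  have h := cos_azimuth_sub_le ha hb hab
  obtain ⟨hla, hua⟩ := level_spec ha
  obtain ⟨hlb, hub⟩ := level_spec hb
  have le_third {i : ℕ} (hi : i ≤ 7) : (i / 21 : ℝ) ≤ 1 / 3 := by
    have : (i : ℝ) ≤ 7 := by exact_mod_cast hi
    linarith
  have hA := le_third (levelMax_le (level a))
  have hB := le_third (levelMax_le (level b))
  have hM := le_third (max_le (levelMax_le (level a)) (levelMax_le (level b)))
  have hpos : 0 < 2 * (1 - |a.2.2|) * (1 - |b.2.2|) := by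
    have : 0 < 1 - |b.2.2| := by linarith
    have : 0 < 1 - |a.2.2| := by linarith
    positivity
  cases hs : (isLower a ^^ isLower b) with
  | true =>
    have hd : |a.2.2 - b.2.2| = |a.2.2| + |b.2.2| := by
      unfold isLower at hs
      grind
    rw [pairBound, hs]
    refine le_trans ?_ (oppCos_le_cos_angleBound _ _)
    refine le_trans ?_ (oppCos_mono (abs_nonneg _) hua hA (abs_nonneg _) hub hB)
    rw [oppCos, le_div_iff₀ hpos]
    rw [hd] at h
    linarith
  | false =>
    have hd : |a.2.2 - b.2.2| = |(|a.2.2| - |b.2.2|)| := by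
      unfold isLower at hs
      grind
    rw [hd] at h
    rw [pairBound, hs]
    refine le_trans ?_ (sameCos_le_cos_angleBound _ _)
    have min_le {i j : ℕ} (hij : i ≤ j) {u : ℝ} (hu : (j / 21 : ℝ) ≤ u) : (i / 21 : ℝ) ≤ u :=
      le_trans (by gcongr) hu
    have le_max {i j : ℕ} (hij : i ≤ j) {u : ℝ} (hu : u ≤ (i / 21 : ℝ)) : u ≤ (j / 21 : ℝ) :=
      le_trans hu (by gcongr)
    rcases le_total |a.2.2| |b.2.2| with hle | hle
    · refine le_trans ?_ (sameCos_mono (min_le (min_le_left _ _) hla) (by linarith)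
        (le_max (le_max_right _ _) hub) hM)
      rw [sameCos, le_div_iff₀ hpos]
      rw [abs_of_nonpos (sub_nonpos.2 hle)] at h
      linarith
    · refine le_trans ?_ (sameCos_mono (min_le (min_le_right _ _) hlb) (by linarith)
        (le_max (le_max_left _ _) hua) hM)
      rw [sameCos, le_div_iff₀ (by linarith)]
      rw [abs_of_nonneg (sub_nonneg.2 hle)] at h
      linarith

theorem pairBound_le {a b : ℝ × ℝ × ℝ} (ha : a ∈ middleBand) (hb : b ∈ middleBand)
    (hab : 1 ≤ pettyDist a b) {δ : ℝ} (hδ : 0 ≤ δ)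
    (hcos : Real.cos δ = Real.cos (azimuth a - azimuth b)) : (pairBound a b / 1000 : ℝ) ≤ δ := by
  by_contra! hlt
  have h3 : (pairBound a b : ℝ) ≤ 3000 := by exact_mod_cast angleBound_le_3000 _ _ _
  have := Real.cos_lt_cos_of_nonneg_of_le_pi hδ (by linarith [Real.pi_gt_three]) hlt
  linarith [cos_azimuth_sub_le_cos_pairBound ha hb hab]

/-! ### Ten points in cyclic order -/

theorem azimuth_injOn {T : Set (ℝ × ℝ × ℝ)} (hT : T ⊆ middleBand) (hsep : OneSeparated T) :
    Set.InjOn azimuth T := by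
  intro a ha b hb hab
  by_contra hne
  have h := pairBound_le (hT ha) (hT hb) (hsep a ha b hb hne) le_rfl (by rw [hab, sub_self])
  have : (0 : ℝ) < pairBound a b := by exact_mod_cast angleBound_pos _ _ _
  linarith

theorem exists_strictMono_azimuth {T : Finset (ℝ × ℝ × ℝ)} {n : ℕ} (hcard : T.card = n)
    (hinj : Set.InjOn azimuth T) :
    ∃ P : Fin n → ℝ × ℝ × ℝ, (∀ i, P i ∈ T) ∧ StrictMono (azimuth ∘ P) := by
  have hc : (T.image azimuth).card = n := by rw [Finset.card_image_of_injOn hinj, hcard]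
  have hex (i : Fin n) : ∃ p ∈ T, azimuth p = (T.image azimuth).orderEmbOfFin hc i :=
    Finset.mem_image.1 (Finset.orderEmbOfFin_mem _ hc i)
  choose P hP hPeq using hex
  refine ⟨P, hP, fun i j hij => ?_⟩
  simp only [Function.comp_apply, hPeq]
  exact (OrderEmbedding.strictMono _) hij

theorem card_ne_ten {T : Finset (ℝ × ℝ × ℝ)} (hT : (T : Set (ℝ × ℝ × ℝ)) ⊆ middleBand)
    (hsep : OneSeparated T) : T.card ≠ 10 := by
  intro hcard
  obtain ⟨P, hP, hmono⟩ := exists_strictMono_azimuth hcard (azimuth_injOn hT hsep)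
  have hPinj : Function.Injective P := hmono.injective.of_comp
  let Q (n : ℕ) : ℝ × ℝ × ℝ := P (Fin.ofNat 10 n)
  let t (n : ℕ) : ℝ := azimuth (Q n) + (n / 10 : ℕ) * (2 * Real.pi)
  have hQ (n : ℕ) : Q n ∈ T := hP _
  have ht : Monotone t := by
    refine monotone_nat_of_le_succ fun n => ?_
    by_cases h : n % 10 = 9
    · have hdiv : (n + 1) / 10 = n / 10 + 1 := by omega
      have h1 : azimuth (Q n) ≤ Real.pi := Complex.arg_le_pi _
      have h2 : -Real.pi < azimuth (Q (n + 1)) := Complex.neg_pi_lt_arg _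
      simp only [t, hdiv]
      push_cast
      linarith
    · have hdiv : (n + 1) / 10 = n / 10 := by omega
      have hlt : Fin.ofNat 10 n < Fin.ofNat 10 (n + 1) := by
        simp only [Fin.lt_def, Fin.ofNat]
        omega
      have := hmono hlt
      simp only [t, hdiv]
      simp only [Function.comp_apply] at this
      simpa [Q] using this.le
  have hgap (m n : ℕ) (hmn : m < n) (hn : n < m + 10) :
      (pairBound (Q m) (Q n) / 1000 : ℝ) ≤ t n - t m := by
    have hne : Q m ≠ Q n := fun h => by
      have := congrArg Fin.val (hPinj h)
      simp only [Fin.ofNat] at this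
      omega
    refine pairBound_le (hT (hQ m)) (hT (hQ n)) (hsep _ (hQ m) _ (hQ n) hne)
      (sub_nonneg.2 (ht hmn.le)) ?_
    have : t n - t m = azimuth (Q n) - azimuth (Q m) +
        (((n / 10 : ℕ) : ℤ) - ((m / 10 : ℕ) : ℤ) : ℤ) * (2 * Real.pi) := by
      simp only [t, Int.cast_sub, Int.cast_natCast]
      ring
    rw [this, Real.cos_add_int_mul_two_pi, ← Real.cos_neg, neg_sub]
  let V (n : ℕ) : ℝ := potential (isLower (Q n) ^^ isLower (Q (n + 1))) (level (Q n))
    (level (Q (n + 1)))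
  have hstep (n : ℕ) : 1257 / 1000 + V n / 1000 ≤ t (n + 2) - t n + V (n + 1) / 1000 := by
    have h := potential_step (isLower (Q n) ^^ isLower (Q (n + 1)))
      (isLower (Q (n + 1)) ^^ isLower (Q (n + 2))) (level (Q n)) (level (Q (n + 1)))
      (level (Q (n + 2)))
    rw [show ((isLower (Q n) ^^ isLower (Q (n + 1))) ^^ (isLower (Q (n + 1)) ^^ isLower (Q (n + 2))))
      = (isLower (Q n) ^^ isLower (Q (n + 2))) by
        cases isLower (Q n) <;> cases isLower (Q (n + 1)) <;> cases isLower (Q (n + 2)) <;> rfl] at h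
    have h1 := hgap n (n + 1) (by omega) (by omega)
    have h2 := hgap (n + 1) (n + 2) (by omega) (by omega)
    have h3 := hgap n (n + 2) (by omega) (by omega)
    change 1257 + _ ≤ max (pairBound _ _ + pairBound _ _) (pairBound _ _) + _ at h
    have h' : (1257 : ℝ) + V n ≤ max ((pairBound (Q n) (Q (n + 1)) : ℝ) +
      pairBound (Q (n + 1)) (Q (n + 2))) (pairBound (Q n) (Q (n + 2))) + V (n + 1) := by
      simp only [V]
      exact_mod_cast h
    have : max ((pairBound (Q n) (Q (n + 1)) : ℝ) + pairBound (Q (n + 1)) (Q (n + 2)))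
        (pairBound (Q n) (Q (n + 2))) ≤ 1000 * (t (n + 2) - t n) :=
      max_le (by linarith) (by linarith)
    linarith
  have hsum (n : ℕ) : t 0 + t 1 + V 0 / 1000 + n * (1257 / 1000) ≤ t n + t (n + 1) + V n / 1000 := by
    induction n with
    | zero => simp
    | succ n ih =>
      have := hstep n
      push_cast
      linarith
  have hQ10 (n : ℕ) : Q (n + 10) = Q n := by
    have : Fin.ofNat 10 (n + 10) = Fin.ofNat 10 n := by
      simp [Fin.ofNat]
    simp only [Q, this]
  have hV10 : V 10 = V 0 := by
    simp only [V, hQ10 0, hQ10 1]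
  have ht10 (n : ℕ) : t (n + 10) = t n + 2 * Real.pi := by
    have hdiv : (n + 10) / 10 = n / 10 + 1 := by omega
    simp only [t, hQ10, hdiv]
    push_cast
    ring
  have h := hsum 10
  rw [hV10, show t (10 + 1) = t 1 + 2 * Real.pi from ht10 1,
    show t 10 = t 0 + 2 * Real.pi from ht10 0] at h
  push_cast at h
  linarith [Real.pi_lt_d4]

/-- for a 1-separated subset S of the Petty unit sphere,
if |S ∩ D₀| = 10 then |S| ≤ 16. -/
theorem oneSeparated_middle_ten (S : Set (ℝ × ℝ × ℝ)) (hsep : OneSeparated S)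
    (hS : S ⊆ pettySphere)
    (h0 : (S ∩ {a ∈ pettySphere | -(1/3) ≤ a.2.2 ∧ a.2.2 ≤ 1/3}).encard = 10) :
    S.encard ≤ 16 := by
  exfalso
  have hfin : (S ∩ middleBand).Finite := Set.finite_of_encard_eq_coe (k := 10) h0
  refine card_ne_ten (T := hfin.toFinset) (by simp) (fun a ha b hb hab => ?_) ?_
  · simp only [Set.Finite.coe_toFinset] at ha hb
    exact hsep a ha.1 b hb.1 hab
  · have h : (S ∩ middleBand).encard = 10 := h0
    rw [hfin.encard_eq_coe_toFinset_card] at h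
    exact_mod_cast h
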